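/- Suppose Assumptions 1–4 hold and the inverse demand function p is convex. Let x be a Cournot candidate with aggregate supply X and let x^S be a social optimum with aggregate supply X^S. If p(X) ≠ p(X^S), let c = |p'(X)|, d = |(p(X^S) − p(X))/(X^S − X)|, and c̄ = c/d. Then c̄ ≥ 1 and 1 > γ(x) ≥ f(c̄). -/

import Mathlib

open Finset Set

noncomputable section

/-- Assumption 1: the cost function `C` (with derivative `C'`) is convex, continuous,
nondecreasing on `[0,∞)`, continuously differentiable on `(0,∞)`, has right derivative
`C' 0` at `0`, and `C 0 = 0`. -/
def CostAssumption (C C' : ℝ → ℝ) : Prop :=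
  ConvexOn ℝ (Set.Ici 0) C ∧
  ContinuousOn C (Set.Ici 0) ∧
  MonotoneOn C (Set.Ici 0) ∧
  (∀ x : ℝ, 0 < x → HasDerivAt C (C' x) x) ∧
  ContinuousOn C' (Set.Ioi 0) ∧
  HasDerivWithinAt C (C' 0) (Set.Ici 0) 0 ∧
  C 0 = 0

/-- Assumption 2: the inverse demand function `p` is continuous, nonnegative and
nonincreasing on `[0,∞)`, with `p 0 > 0`; `pr q` is the right derivative of `p`
at every `q ≥ 0` and `pl q` is the left derivative of `p` at every `q > 0`. -/
def DemandAssumption (p pl pr : ℝ → ℝ) : Prop :=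
  ContinuousOn p (Set.Ici 0) ∧
  (∀ q : ℝ, 0 ≤ q → 0 ≤ p q) ∧
  AntitoneOn p (Set.Ici 0) ∧
  0 < p 0 ∧
  HasDerivWithinAt p (pr 0) (Set.Ici 0) 0 ∧
  (∀ q : ℝ, 0 < q → HasDerivWithinAt p (pr q) (Set.Ici q) q) ∧
  (∀ q : ℝ, 0 < q → HasDerivWithinAt p (pl q) (Set.Iic q) q)

/-- The social welfare of the supply vector `x`. -/
def SW {N : ℕ} (C : Fin N → ℝ → ℝ) (p : ℝ → ℝ) (x : Fin N → ℝ) : ℝ :=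
  (∫ q in (0:ℝ)..(∑ n, x n), p q) - ∑ n, C n (x n)

/-- A social optimum: a nonnegative vector maximizing the social welfare. -/
def SocialOptimum {N : ℕ} (C : Fin N → ℝ → ℝ) (p : ℝ → ℝ) (x : Fin N → ℝ) : Prop :=
  (∀ n, 0 ≤ x n) ∧ ∀ y : Fin N → ℝ, (∀ n, 0 ≤ y n) → SW C p y ≤ SW C p x

/-- A Cournot candidate: a nonnegative vector satisfying the first-order necessary
conditions for a Cournot equilibrium. -/
def CournotCandidate {N : ℕ} (C' : Fin N → ℝ → ℝ) (p pl pr : ℝ → ℝ)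
    (x : Fin N → ℝ) : Prop :=
  (∀ n, 0 ≤ x n) ∧
  ∀ n, (0 < x n → C' n (x n) ≤ p (∑ m, x m) + x n * pl (∑ m, x m)) ∧
       p (∑ m, x m) + x n * pr (∑ m, x m) ≤ C' n (x n)

/-- A Cournot equilibrium: each supplier's quantity is a best response. -/
def CournotEquilibrium {N : ℕ} (C : Fin N → ℝ → ℝ) (p : ℝ → ℝ) (x : Fin N → ℝ) : Prop :=
  (∀ n, 0 ≤ x n) ∧
  ∀ n, ∀ z : ℝ, 0 ≤ z →
    z * p (z + ∑ m ∈ Finset.univ.erase n, x m) - C n z ≤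
      x n * p (x n + ∑ m ∈ Finset.univ.erase n, x m) - C n (x n)

/-- A monopoly output: a nonnegative vector maximizing total profit. -/
def MonopolyOutput {N : ℕ} (C : Fin N → ℝ → ℝ) (p : ℝ → ℝ) (x : Fin N → ℝ) : Prop :=
  (∀ n, 0 ≤ x n) ∧
  ∀ y : Fin N → ℝ, (∀ n, 0 ≤ y n) →
    p (∑ n, y n) * (∑ n, y n) - ∑ n, C n (y n) ≤
      p (∑ n, x n) * (∑ n, x n) - ∑ n, C n (x n)

/-- The quantity `φ` appearing in the efficiency bound `f`. -/
def phi (c : ℝ) : ℝ := max ((2 - c + Real.sqrt (c ^ 2 - 4 * c + 12)) / 2) 1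

/-- The efficiency lower bound `f(c̄) = (φ² + 2)/(φ² + 2φ + c̄)`. -/
def fbound (c : ℝ) : ℝ := (phi c ^ 2 + 2) / (phi c ^ 2 + 2 * phi c + c)

lemma cost_tangent {C C' : ℝ → ℝ} (h : CostAssumption C C') {x y : ℝ} (hx : 0 ≤ x) (hy : 0 ≤ y) :
    C x + C' x * (y - x) ≤ C y := by
  obtain ⟨hcv, -, -, hd, -, hd0, -⟩ := h
  rcases lt_trichotomy x y with hxy | hxy | hxy
  · have hr : HasDerivWithinAt C (C' x) (Set.Ioi x) x := by
      rcases hx.eq_or_lt with h0 | h0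
      · subst h0; exact hd0.mono Set.Ioi_subset_Ici_self
      · exact (hd x h0).hasDerivWithinAt
    have := hcv.le_slope_of_hasDerivWithinAt_Ioi (x := x) (y := y) hx hy hxy hr
    rw [slope_def_field, le_div_iff₀ (by linarith)] at this
    linarith
  · subst hxy; simp
  · have hr : HasDerivWithinAt C (C' x) (Set.Iio x) x := (hd x (by linarith)).hasDerivWithinAt
    have := hcv.slope_le_of_hasDerivWithinAt_Iio (x := y) (y := x) hy hx hxy hr
    rw [slope_def_field, div_le_iff₀ (by linarith)] at this
    linarith

lemma cost_deriv_mono {C C' : ℝ → ℝ} (h : CostAssumption C C') {x y : ℝ} (hx : 0 ≤ x)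
    (hxy : x < y) : C' x ≤ C' y := by
  have h1 := cost_tangent h hx (hx.trans hxy.le)
  have h2 := cost_tangent h (hx.trans hxy.le) hx
  nlinarith

lemma right_max {F : ℝ → ℝ} {m a : ℝ} (hF : HasDerivWithinAt F m (Set.Ici a) a)
    (hmax : ∀ z, a ≤ z → F z ≤ F a) : m ≤ 0 := by
  have h := (hasDerivWithinAt_iff_tendsto_slope' (s := Set.Ioi a) (by simp)).mp
    (hF.mono Set.Ioi_subset_Ici_self)
  refine le_of_tendsto h ?_
  filter_upwards [self_mem_nhdsWithin] with z hz
  have hz' : a < z := hz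
  rw [slope_def_field]
  exact div_nonpos_of_nonpos_of_nonneg (by linarith [hmax z hz'.le]) (by linarith)

lemma foc {N : ℕ} {C C' : Fin N → ℝ → ℝ} {p : ℝ → ℝ}
    (hC : ∀ n, CostAssumption (C n) (C' n)) (hcont : ContinuousOn p (Set.Ici 0))
    {x : Fin N → ℝ} (hx : SocialOptimum C p x) (n : Fin N) :
    p (∑ m, x m) ≤ C' n (x n) ∧ (0 < x n → C' n (x n) ≤ p (∑ m, x m)) := by
  obtain ⟨hx0, hmax⟩ := hx
  set q : ℝ → ℝ := fun t => p (max t 0) with hq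
  have hqc : Continuous q :=
    hcont.comp_continuous (continuous_id.max continuous_const) (fun t => Set.mem_Ici.mpr (le_max_right _ _))
  have hSW : ∀ y : Fin N → ℝ, (∀ m, 0 ≤ y m) → SW C p y = SW C q y := by
    intro y hy
    unfold SW
    congr 1
    apply intervalIntegral.integral_congr
    intro t ht
    have hs : 0 ≤ ∑ m, y m := Finset.sum_nonneg (fun m _ => hy m)
    rw [Set.uIcc_of_le hs] at ht
    simp [hq, max_eq_left ht.1]
  have hX0 : 0 ≤ ∑ m, x m := Finset.sum_nonneg (fun m _ => hx0 m)
  set F : ℝ → ℝ := fun z => (∫ t in (0:ℝ)..(∑ m, x m) + (z - x n), q t) - C n z with hF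
  have hup : ∀ z : ℝ, 0 ≤ z → F z ≤ F (x n) := by
    intro z hz
    have hy : ∀ m, 0 ≤ Function.update x n z m := by
      intro m
      by_cases hm : m = n
      · subst hm; simpa using hz
      · simpa [hm] using hx0 m
    have h := hmax _ hy
    rw [hSW _ hy, hSW _ hx0] at h
    unfold SW at h
    have e1 : ∑ m, Function.update x n z m = ∑ m, x m + (z - x n) := by
      rw [Finset.sum_update_of_mem (Finset.mem_univ n),
        ← Finset.add_sum_erase Finset.univ x (Finset.mem_univ n), Finset.sdiff_singleton_eq_erase]
      ring
    have e2 : ∑ m, C m (Function.update x n z m) = ∑ m, C m (x m) + (C n z - C n (x n)) := by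
      rw [← Finset.add_sum_erase Finset.univ (fun m => C m (x m)) (Finset.mem_univ n),
        ← Finset.add_sum_erase Finset.univ (fun m => C m (Function.update x n z m))
          (Finset.mem_univ n)]
      have : ∑ m ∈ Finset.univ.erase n, C m (Function.update x n z m)
          = ∑ m ∈ Finset.univ.erase n, C m (x m) := by
        apply Finset.sum_congr rfl
        intro m hm
        simp [Finset.ne_of_mem_erase hm]
      rw [this]; simp; ring
    rw [e1, e2] at h
    simp only [hF, sub_self, add_zero]
    linarith
  have hI : HasDerivAt (fun z => ∫ t in (0:ℝ)..(∑ m, x m) + (z - x n), q t)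
      (p (∑ m, x m)) (x n) := by
    have h1 : HasDerivAt (fun u => ∫ t in (0:ℝ)..u, q t) (q (∑ m, x m + (x n - x n)))
        (∑ m, x m + (x n - x n)) :=
      intervalIntegral.integral_hasDerivAt_right (hqc.intervalIntegrable _ _)
        (hqc.stronglyMeasurableAtFilter _ _) hqc.continuousAt
    have h2 : HasDerivAt (fun z => (∑ m, x m) + (z - x n)) 1 (x n) :=
      ((hasDerivAt_id (x n)).sub_const _).const_add _
    have h3 := h1.comp (x n) h2
    have e : q (∑ m, x m + (x n - x n)) * 1 = p (∑ m, x m) := by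
      simp [hq, max_eq_left hX0]
    rw [e] at h3
    exact h3
  obtain ⟨-, -, -, hd, -, hd0, -⟩ := hC n
  constructor
  · have hCd : HasDerivWithinAt (C n) (C' n (x n)) (Set.Ici (x n)) (x n) := by
      rcases (hx0 n).eq_or_lt with h0 | h0
      · rw [← h0]; exact hd0
      · exact (hd _ h0).hasDerivWithinAt
    have := right_max (F := F) (hI.hasDerivWithinAt.sub hCd)
      (fun z hz => hup z ((hx0 n).trans hz))
    linarith
  · intro h0
    have hloc : IsLocalMax F (x n) := by
      filter_upwards [Ioi_mem_nhds h0] with z hz using hup z (le_of_lt hz)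
    have := hloc.hasDerivAt_eq_zero (hI.sub (hd _ h0))
    linarith

lemma fbound_le {c Y : ℝ} (hc : 1 ≤ c) (hY : 1 ≤ Y) :
    0 ≤ fbound c ∧ fbound c ≤ 1 ∧ fbound c * (Y ^ 2 + 2 * Y + c) ≤ Y ^ 2 + 2 := by
  unfold fbound
  set s := Real.sqrt (c ^ 2 - 4 * c + 12) with hs
  have hs2 : s ^ 2 = c ^ 2 - 4 * c + 12 := Real.sq_sqrt (by nlinarith [sq_nonneg (c - 2)])
  have hs0 : 0 ≤ s := Real.sqrt_nonneg _
  have hφ1 : 1 ≤ phi c := le_max_right _ _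
  have hcase : phi c ^ 2 + (c - 2) * phi c = 2 ∨ (phi c = 1 ∧ 3 ≤ c) := by
    unfold phi
    rw [← hs]
    rcases le_total ((2 - c + s) / 2) 1 with h | h
    · right
      refine ⟨max_eq_right h, ?_⟩
      nlinarith
    · left
      rw [max_eq_left h]
      nlinarith
  generalize phi c = φ at *
  have hden : 0 < φ ^ 2 + 2 * φ + c := by positivity
  refine ⟨by positivity, ?_, ?_⟩
  · rw [div_le_one hden]; linarith
  · rw [div_mul_eq_mul_div, div_le_iff₀ hden]
    have key : 0 ≤ (Y - φ) * (2 * Y * φ + (c - 2) * (Y + φ) - 4) := by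
      rcases hcase with h | ⟨h, h3⟩
      · have e : φ * ((Y - φ) * (2 * Y * φ + (c - 2) * (Y + φ) - 4))
            = (Y - φ) ^ 2 * (φ ^ 2 + 2) := by
          linear_combination (Y - φ) * (Y + φ) * h
        have : 0 ≤ φ * ((Y - φ) * (2 * Y * φ + (c - 2) * (Y + φ) - 4)) := by
          rw [e]; positivity
        exact nonneg_of_mul_nonneg_right this (by linarith)
      · subst h
        apply mul_nonneg <;> nlinarith
    nlinarith

lemma left_le_right {p : ℝ → ℝ} (hconv : ConvexOn ℝ (Set.Ici 0) p) {X l r : ℝ} (hX : 0 < X)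
    (hl : HasDerivWithinAt p l (Set.Iic X) X) (hr : HasDerivWithinAt p r (Set.Ici X) X) :
    l ≤ r := by
  have := hconv.leftDeriv_le_rightDeriv_of_mem_interior (x := X) (by simpa using hX)
  rwa [(hl.mono Set.Iio_subset_Iic_self).derivWithin (uniqueDiffWithinAt_Iio X),
    (hr.mono Set.Ioi_subset_Ici_self).derivWithin (uniqueDiffWithinAt_Ioi X)] at this

lemma int_affine (a b P m u : ℝ) :
    ∫ t in a..b, (P + m * (t - u)) = P * (b - a) + m * ((b - u) ^ 2 - (a - u) ^ 2) / 2 := by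
  have h : ∀ t ∈ Set.uIcc a b, HasDerivAt (fun t => P * t + m * (t - u) ^ 2 / 2)
      (P + m * (t - u)) t := by
    intro t _
    have h1 : HasDerivAt (fun t => (t - u) ^ 2) (2 * (t - u)) t := by
      have := ((hasDerivAt_id' t).sub_const u).fun_pow 2
      simpa using this
    have := ((hasDerivAt_id' t).const_mul P).fun_add ((h1.const_mul m).div_const 2)
    have e : P * 1 + m * (2 * (t - u)) / 2 = P + m * (t - u) := by ring
    rw [e] at this
    exact this
  rw [intervalIntegral.integral_eq_sub_of_hasDerivAt h
    (Continuous.intervalIntegrable (by fun_prop) _ _)]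
  ring

set_option maxHeartbeats 1000000 in
/-- Main theorem: efficiency lower bound `f(c̄)` for Cournot candidates under convex
inverse demand. -/
theorem convex_demand_efficiency {N : ℕ} (hN : 0 < N)
    (C C' : Fin N → ℝ → ℝ) (p pl pr : ℝ → ℝ)
    (hC : ∀ n, CostAssumption (C n) (C' n))
    (hp : DemandAssumption p pl pr)
    (hA3 : ∃ R : ℝ, 0 < R ∧ ∀ n, p R ≤ C' n 0)
    (hA4 : ∃ n, C' n 0 < p 0)
    (hconv : ConvexOn ℝ (Set.Ici 0) p)
    (x xS : Fin N → ℝ)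
    (hx : CournotCandidate C' p pl pr x)
    (hxS : SocialOptimum C p xS)
    (hne : p (∑ n, x n) ≠ p (∑ n, xS n))
    (c d : ℝ) (hc : c = |pr (∑ n, x n)|)
    (hd : d = |(p (∑ n, xS n) - p (∑ n, x n)) / ((∑ n, xS n) - ∑ n, x n)|) :
    1 ≤ c / d ∧
    SW C p x / SW C p xS < 1 ∧
    fbound (c / d) ≤ SW C p x / SW C p xS := by
  obtain ⟨hcont, hpnn, hanti, hp0, hpr0, hpr, hpl⟩ := hp
  have hfS := foc hC hcont hxS
  have hx0 := hx.1
  have hxS0 := hxS.1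
  have hxc := hx.2
  set X := ∑ n, x n with hX
  set XS := ∑ n, xS n with hXS
  have hX0 : 0 ≤ X := Finset.sum_nonneg (fun m _ => hx0 m)
  have hXS0 : 0 ≤ XS := Finset.sum_nonneg (fun m _ => hxS0 m)
  have hXpos : 0 < X := by
    rcases hX0.eq_or_lt with h | h
    · exfalso
      obtain ⟨n, hn⟩ := hA4
      have hz : x n = 0 :=
        (Finset.sum_eq_zero_iff_of_nonneg (fun m _ => hx0 m)).mp h.symm n (Finset.mem_univ n)
      have := (hxc n).2
      rw [← h, hz] at this
      linarith
    · exact h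
  have hlr : pl X ≤ pr X := left_le_right hconv hXpos (hpl X hXpos) (hpr X hXpos)
  -- left tangent
  have hltan : ∀ y, 0 ≤ y → y ≤ X → p X + pr X * (y - X) ≤ p y := by
    intro y hy hyX
    rcases hyX.eq_or_lt with h | h
    · rw [h]; simp
    · have := hconv.slope_le_of_hasDerivWithinAt_Iio (x := y) (y := X) hy hX0 h
        ((hpl X hXpos).mono Set.Iio_subset_Iic_self)
      rw [slope_def_field, div_le_iff₀ (by linarith)] at this
      nlinarith
  have hrtan : ∀ y, X < y → p X + pr X * (y - X) ≤ p y := by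
    intro y h
    have := hconv.le_slope_of_hasDerivWithinAt_Ioi (x := X) (y := y) hX0
      (hX0.trans h.le) h ((hpr X hXpos).mono Set.Ioi_subset_Ici_self)
    rw [slope_def_field, le_div_iff₀ (by linarith)] at this
    linarith
  have hprle : pr X ≤ 0 := by
    have h1 := hrtan (X + 1) (by linarith)
    have h2 := hanti (a := X) (b := X + 1) hX0 (Set.mem_Ici.mpr (by linarith)) (by linarith)
    linarith
  have hlt : X < XS := by
    by_contra hge
    push Not at hge
    have hPP : p X < p XS := lt_of_le_of_ne (hanti hXS0 hX0 hge) hne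
    have hlt' : XS < X := by
      rcases hge.eq_or_lt with h | h
      · rw [h] at hPP; exact absurd hPP (lt_irrefl _)
      · exact h
    obtain ⟨n, -, hn⟩ := Finset.exists_lt_of_sum_lt (hXS ▸ hX ▸ hlt' : ∑ n, xS n < ∑ n, x n)
    have h1 := (hxc n).1 (lt_of_le_of_lt (hxS0 n) hn)
    have h2 := (hfS n).1
    have h3 := cost_deriv_mono (hC n) (hxS0 n) hn
    have h4 : x n * pl X ≤ 0 :=
      mul_nonpos_of_nonneg_of_nonpos (hx0 n) (hlr.trans hprle)
    linarith
  have hPP : p XS < p X := lt_of_le_of_ne (hanti hX0 hXS0 hlt.le) (Ne.symm hne)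
  have ht : 0 < XS - X := by linarith
  have hd1 : d = (p X - p XS) / (XS - X) := by
    rw [hd, abs_div, abs_of_neg (by linarith : p XS - p X < 0), abs_of_pos ht, neg_sub]
  have hdpos : 0 < d := by rw [hd1]; exact div_pos (by linarith) ht
  have hdt : d * (XS - X) = p X - p XS := by rw [hd1]; field_simp
  have hc1 : pr X = -c := by rw [hc, abs_of_nonpos hprle]; ring
  have hcd : d ≤ c := by
    have := hrtan XS hlt
    rw [hc1] at this
    nlinarith
  have hcpos : 0 < c := hdpos.trans_le hcd
  have hcd1 : 1 ≤ c / d := by rw [le_div_iff₀ hdpos]; linarith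
  obtain ⟨i, -, hi⟩ := Finset.exists_max_image Finset.univ x ⟨⟨0, hN⟩, Finset.mem_univ _⟩
  have hi' : ∀ n, x n ≤ x i := fun n => hi n (Finset.mem_univ n)
  have hxi : 0 < x i := by
    by_contra h
    have : X ≤ 0 := Finset.sum_nonpos (fun n _ => (hi' n).trans (not_lt.mp h))
    linarith
  have hxiX : x i ≤ X := Finset.single_le_sum (fun m _ => hx0 m) (Finset.mem_univ i)
  -- marginal costs
  have hlow : ∀ n, p X - c * x n ≤ C' n (x n) := by
    intro n
    have := (hxc n).2
    rw [hc1] at this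
    linarith
  have hhigh : ∀ n, 0 < x n → C' n (x n) ≤ p X - c * x n := by
    intro n hn
    have := (hxc n).1 hn
    have h2 : pl X ≤ -c := hc1 ▸ hlr
    nlinarith
  have hdtc : d * (XS - X) ≤ c * x i := by
    obtain ⟨n, -, hn⟩ := Finset.exists_lt_of_sum_lt (hXS ▸ hX ▸ hlt : ∑ n, x n < ∑ n, xS n)
    have h1 := cost_deriv_mono (hC n) (hx0 n) hn
    have h2 := (hfS n).2 (lt_of_le_of_lt (hx0 n) hn)
    have h3 := hlow n
    have h4 := mul_le_mul_of_nonneg_left (hi' n) hcpos.le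
    linarith
  -- integrals
  have hint : ∀ a b, 0 ≤ a → 0 ≤ b → IntervalIntegrable p MeasureTheory.volume a b := by
    intro a b ha hb
    apply ContinuousOn.intervalIntegrable
    apply hcont.mono
    intro t ht
    exact Set.mem_Ici.mpr ((le_min ha hb).trans ht.1)
  have hI1 : p X * X + c * X ^ 2 / 2 ≤ ∫ q in (0:ℝ)..X, p q := by
    have h := intervalIntegral.integral_mono_on hX0
      (Continuous.intervalIntegrable (u := fun t => p X + (-c) * (t - X)) (by fun_prop) 0 X)
      (hint 0 X le_rfl hX0) (fun t ht => by
        have := hltan t ht.1 ht.2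
        rw [hc1] at this
        exact this)
    rw [int_affine] at h
    nlinarith
  have hI2 : ∫ q in X..XS, p q ≤ p X * (XS - X) - d * (XS - X) ^ 2 / 2 := by
    have h := intervalIntegral.integral_mono_on hlt.le (hint X XS hX0 hXS0)
      (Continuous.intervalIntegrable (u := fun t => p X + (-d) * (t - X)) (by fun_prop) X XS)
      (fun t ht => by
        rcases ht.1.eq_or_lt with h | h
        · rw [← h]; simp
        · have := hconv.secant_mono (a := X) (x := t) (y := XS) hX0 (hX0.trans h.le) hXS0
            h.ne' hlt.ne' ht.2
          have e : (p XS - p X) / (XS - X) = -d := by rw [hd1, ← neg_div, neg_sub]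
          rw [e, div_le_iff₀ (by linarith)] at this
          linarith)
    rw [int_affine] at h
    nlinarith
  have hIadd : (∫ q in (0:ℝ)..XS, p q) = (∫ q in (0:ℝ)..X, p q) + ∫ q in X..XS, p q :=
    (intervalIntegral.integral_add_adjacent_intervals (hint 0 X le_rfl hX0)
      (hint X XS hX0 hXS0)).symm
  set S := ∑ n, x n ^ 2 with hS
  have hSi : x i ^ 2 ≤ S :=
    Finset.single_le_sum (f := fun n => x n ^ 2) (fun m _ => sq_nonneg _) (Finset.mem_univ i)
  -- lower bound on SW x
  have hcost1 : ∑ n, C n (x n) ≤ p X * X - c * S := by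
    rw [hX, hS, Finset.mul_sum, Finset.mul_sum, ← Finset.sum_sub_distrib]
    apply Finset.sum_le_sum
    intro n _
    have h1 := cost_tangent (hC n) (hx0 n) le_rfl
    rw [(hC n).2.2.2.2.2.2] at h1
    rcases (hx0 n).eq_or_lt with h | h
    · rw [← h] at h1 ⊢
      simp at h1 ⊢
      linarith
    · have := mul_le_mul_of_nonneg_right (hhigh n h) h.le
      linarith
  have hA : c * (X ^ 2 / 2 + S) ≤ SW C p x := by
    unfold SW
    rw [← hX]
    linarith
  -- upper bound on the loss
  have hcost2 : (p X - c * x i) * (XS - X) - c * (x i * X - S)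
      ≤ ∑ n, C n (xS n) - ∑ n, C n (x n) := by
    have e : (p X - c * x i) * (XS - X) - c * (x i * X - S)
        = ∑ n, ((p X - c * x i) * (xS n - x n) - c * (x i * x n - x n ^ 2)) := by
      rw [Finset.sum_sub_distrib, ← Finset.mul_sum, ← Finset.mul_sum, Finset.sum_sub_distrib,
        Finset.sum_sub_distrib, ← Finset.mul_sum]
    rw [e, ← Finset.sum_sub_distrib]
    apply Finset.sum_le_sum
    intro n _
    have h1 := cost_tangent (hC n) (hx0 n) (hxS0 n)
    have h2 := hlow n
    have h3 := hi' n
    have h4 := hxS0 n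
    have h5 : 0 ≤ (C' n (x n) - (p X - c * x i)) * xS n :=
      mul_nonneg (by linarith [mul_le_mul_of_nonneg_left h3 hcpos.le]) h4
    rcases (hx0 n).eq_or_lt with h | h
    · rw [← h] at h1 h5 ⊢
      linarith
    · have := mul_le_mul_of_nonneg_right (hhigh n h) h.le
      linarith
  have hq : c * x i * (XS - X) - d * (XS - X) ^ 2 / 2 ≤ c * (c / d * x i ^ 2 / 2) := by
    have e : c * (c / d * x i ^ 2 / 2) - (c * x i * (XS - X) - d * (XS - X) ^ 2 / 2)
        = (c * x i - d * (XS - X)) ^ 2 / (2 * d) := by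
      field_simp
      ring
    have : 0 ≤ (c * x i - d * (XS - X)) ^ 2 / (2 * d) := by positivity
    linarith
  have hL : SW C p xS ≤ SW C p x + c * (c / d * x i ^ 2 / 2 + x i * X - S) := by
    unfold SW
    rw [← hX, ← hXS, hIadd]
    linarith
  have hSWpos : 0 < SW C p x :=
    lt_of_lt_of_le (mul_pos hcpos (by nlinarith)) hA
  have hle := hxS.2 x hx0
  have hSpos : 0 < SW C p xS := hSWpos.trans_le hle
  refine ⟨hcd1, ?_, ?_⟩
  · rw [div_lt_one hSpos]
    refine lt_of_le_of_ne hle ?_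
    intro heq
    have hopt : SocialOptimum C p x := ⟨hx0, fun y hy => heq ▸ hxS.2 y hy⟩
    have h1 := (foc hC hcont hopt i).1
    have h2 := hhigh i hxi
    have h3 := mul_pos hcpos hxi
    linarith
  · rw [le_div_iff₀ hSpos]
    obtain ⟨hf0, hf1, hf2⟩ := fbound_le (c := c / d) (Y := X / x i) hcd1
      (by rw [le_div_iff₀ hxi]; linarith)
    generalize fbound (c / d) = f at *
    generalize c / d = k at *
    have hf3 : f * (X ^ 2 + 2 * X * x i + k * x i ^ 2) ≤ X ^ 2 + 2 * x i ^ 2 := by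
      have := mul_le_mul_of_nonneg_right hf2 (sq_nonneg (x i))
      have e1 : f * ((X / x i) ^ 2 + 2 * (X / x i) + k) * x i ^ 2
          = f * (X ^ 2 + 2 * X * x i + k * x i ^ 2) := by field_simp
      have e2 : ((X / x i) ^ 2 + 2) * x i ^ 2 = X ^ 2 + 2 * x i ^ 2 := by field_simp
      rwa [e1, e2] at this
    have g1 := mul_le_mul_of_nonneg_left hL hf0
    have g2 := mul_le_mul_of_nonneg_left hA (sub_nonneg.mpr hf1)
    have g3 : c * (f * (X ^ 2 + 2 * X * x i + k * x i ^ 2)) ≤ c * (X ^ 2 + 2 * S) :=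
      mul_le_mul_of_nonneg_left (by linarith) hcpos.le
    linarith

end
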